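/- Let k ≥ 2, let x be a string over Σ of length k−1, and let A, B, C, D be arbitrary (possibly empty) strings over Σ. Then the two reads r = A·x·B·x·C·x·D and r' = A·x·C·x·B·x·D (where · denotes concatenation) have the same length and the same k-mer profile. -/

import Mathlib

/-- The DNA alphabet Σ = {A,C,T,G}, modeled as `Fin 4`. -/
abbrev Base := Fin 4

/-- `kmerCount k r x` is the number of indices `i ∈ {1,…,ℓ−k+1}` (0-indexed here)
such that the length-`k` substring of `r` starting at position `i` equals `x`. -/
def kmerCount (k : ℕ) (r x : List Base) : ℕ :=
  ((List.range (r.length - k + 1)).filter (fun i => decide ((r.drop i).take k = x))).length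

/-- Recursive count of windows of length `k` equal to `z`. -/
def windowCount (k : ℕ) (z : List Base) : List Base → ℕ
  | [] => 0
  | a :: l => (if k ≤ (a :: l).length ∧ (a :: l).take k = z then 1 else 0) + windowCount k z l

theorem windowCount_short (k : ℕ) (z l : List Base) (h : l.length < k) :
    windowCount k z l = 0 := by
  induction l with
  | nil => rfl
  | cons a l ih =>
    have h2 : ¬ k ≤ (a :: l).length := by omega
    simp only [List.length_cons] at h
    rw [windowCount, ih (by omega), if_neg (fun h => h2 h.1)]

theorem kmerCount_eq (k : ℕ) (hk : 1 ≤ k) (z r : List Base) (h : k ≤ r.length) :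
    kmerCount k r z = windowCount k z r := by
  induction r with
  | nil => simp at h; omega
  | cons a l ih =>
    rw [windowCount]
    by_cases hl : k ≤ l.length
    · rw [← ih hl]
      unfold kmerCount
      have e : (a :: l).length - k + 1 = (l.length - k + 1) + 1 := by
        simp only [List.length_cons]; omega
      rw [e, List.range_succ_eq_map, ← List.countP_eq_length_filter,
        ← List.countP_eq_length_filter, List.countP_cons, List.countP_map, Nat.add_comm]
      congr 1
      simp [show k ≤ l.length + 1 by omega]
    · simp only [List.length_cons] at h
      rw [windowCount_short k z l (by omega)]
      unfold kmerCount
      have e : (a :: l).length - k + 1 = 1 := by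
        simp only [List.length_cons]; omega
      rw [e, ← List.countP_eq_length_filter]
      simp [List.range_succ, List.countP_cons, h]

theorem windowCount_split (k : ℕ) (hk : 1 ≤ k) (z x P Q : List Base) (hx : x.length = k - 1) :
    windowCount k z (P ++ (x ++ Q)) = windowCount k z (P ++ x) + windowCount k z (x ++ Q) := by
  induction P with
  | nil => simp [windowCount_short k z x (by omega)]
  | cons a P ih =>
    rw [List.cons_append, List.cons_append, windowCount, windowCount, ih, ← Nat.add_assoc]
    have h1 : k ≤ (a :: (P ++ x)).length := by simp; omega
    have h2 : k ≤ (a :: (P ++ (x ++ Q))).length := by simp; omega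
    have h3 : (a :: (P ++ (x ++ Q))).take k = (a :: (P ++ x)).take k := by
      rw [← List.append_assoc, ← List.cons_append, List.take_append_of_le_length h1]
    rw [h3]
    simp only [h1, h2]

theorem windowCount_triple (k : ℕ) (hk : 1 ≤ k) (z x A B C D : List Base)
    (hx : x.length = k - 1) :
    windowCount k z (A ++ x ++ B ++ x ++ C ++ x ++ D) =
      windowCount k z (A ++ x) + (windowCount k z (x ++ B ++ x) +
        (windowCount k z (x ++ C ++ x) + windowCount k z (x ++ D))) := by
  have h1 := windowCount_split k hk z x A (B ++ x ++ C ++ x ++ D) hx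
  have h2 := windowCount_split k hk z x (x ++ B) (C ++ x ++ D) hx
  have h3 := windowCount_split k hk z x (x ++ C) D hx
  simp only [List.append_assoc] at *
  rw [h1, h2, h3]

/-- Swapping the two segments lying between three occurrences of the (k−1)-mer `x`
preserves the length and the `k`-mer profile. -/
theorem swap_between_triple_repeat_same_profile (k : ℕ) (hk : 2 ≤ k)
    (x A B C D : List Base) (hx : x.length = k - 1) :
    (A ++ x ++ B ++ x ++ C ++ x ++ D).length = (A ++ x ++ C ++ x ++ B ++ x ++ D).length ∧
      ∀ z : List Base,
        kmerCount k (A ++ x ++ B ++ x ++ C ++ x ++ D) z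
          = kmerCount k (A ++ x ++ C ++ x ++ B ++ x ++ D) z := by
  refine ⟨by simp only [List.length_append]; omega, fun z => ?_⟩
  rw [kmerCount_eq k (by omega) z _ (by simp only [List.length_append]; omega),
    kmerCount_eq k (by omega) z _ (by simp only [List.length_append]; omega),
    windowCount_triple k (by omega) z x A B C D hx,
    windowCount_triple k (by omega) z x A C B D hx]
  omega
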